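/- Let g : ℝ → ℝ be a positive C² function on (1, ∞) whose first and second derivatives are non-negative on (1, ∞). Fix a real number α ≠ 0. Then for Lebesgue-almost every real number β > 1, the sequence c_n = e^{2πi α βⁿ g(β)} is a higher order oscillating sequence of order m (stronger version) for every integer m ≥ 2; that is, for every real-coefficient polynomial P, lim_{N→∞} (1/N) ∑_{n=1}^{N} e^{2πi (α βⁿ g(β) + P(n))} = 0. -/

import Mathlib

open Filter Polynomial MeasureTheory

noncomputable def ee (t : ℝ) : ℂ := Complex.exp (2 * Real.pi * Complex.I * (t : ℝ))

noncomputable def avg (u : ℕ → ℂ) (N : ℕ) : ℂ := (1 / N : ℂ) * ∑ n ∈ Finset.range N, u n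

theorem ee_norm (t : ℝ) : ‖ee t‖ = 1 := by
  unfold ee
  rw [show (2 * Real.pi * Complex.I * (t : ℝ) : ℂ) = ((2 * Real.pi * t : ℝ) : ℂ) * Complex.I by
    push_cast; ring]
  exact Complex.norm_exp_ofReal_mul_I _

theorem ee_add (s t : ℝ) : ee (s + t) = ee s * ee t := by
  unfold ee
  rw [← Complex.exp_add]; congr 1; push_cast; ring

theorem ee_conj (t : ℝ) : (starRingEnd ℂ) (ee t) = ee (-t) := by
  unfold ee
  rw [← Complex.exp_conj]; congr 1; simp [Complex.conj_ofNat]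

theorem ee_sub (s t : ℝ) : ee s * (starRingEnd ℂ) (ee t) = ee (s - t) := by
  rw [ee_conj, ← ee_add, sub_eq_add_neg]

theorem norm_sum_le_of_one (u : ℕ → ℂ) (hu : ∀ n, ‖u n‖ = 1) (s : Finset ℕ) :
    ‖∑ n ∈ s, u n‖ ≤ s.card := by
  refine (norm_sum_le _ _).trans ?_
  simp [hu]

theorem avg_shift (u : ℕ → ℂ) (hu : ∀ n, ‖u n‖ = 1) (h : ℕ) :
    Tendsto (fun N => avg (fun n => u (n + h)) N - avg u N) atTop (nhds 0) := by
  apply squeeze_zero_norm (a := fun N : ℕ => (2 * h : ℝ) / N)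
  · intro N
    have e1 : (∑ n ∈ Finset.range N, u (n + h)) - ∑ n ∈ Finset.range N, u n
        = (∑ n ∈ Finset.range h, u (n + N)) - ∑ n ∈ Finset.range h, u n := by
      have h1 := Finset.sum_range_add u N h
      have h2 := Finset.sum_range_add u h N
      rw [add_comm h N, h1] at h2
      simp only [add_comm _ h, add_comm _ N]
      linear_combination -h2
    unfold avg
    rw [← mul_sub, e1, norm_mul]
    have h3 := norm_sum_le_of_one (fun n => u (n + N)) (fun n => hu _) (Finset.range h)
    have h4 := norm_sum_le_of_one u hu (Finset.range h)
    have h5 := norm_sub_le (∑ n ∈ Finset.range h, u (n + N)) (∑ n ∈ Finset.range h, u n)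
    rw [Finset.card_range] at h3 h4
    have : ‖(1 / N : ℂ)‖ = 1 / N := by simp
    rw [this, div_eq_mul_one_div (2 * (h : ℝ)), mul_comm (2 * (h : ℝ))]
    exact mul_le_mul_of_nonneg_left (by linarith) (by positivity)
  · exact tendsto_const_div_atTop_nhds_zero_nat _

theorem avg_one (N : ℕ) (hN : 0 < N) : avg (fun _ => 1) N = 1 := by
  unfold avg
  have : (N : ℂ) ≠ 0 := by exact_mod_cast hN.ne'
  simp [this]

theorem avg_sum {ι : Type*} (s : Finset ι) (u : ι → ℕ → ℂ) (N : ℕ) :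
    avg (fun n => ∑ i ∈ s, u i n) N = ∑ i ∈ s, avg (u i) N := by
  unfold avg
  rw [Finset.sum_comm, Finset.mul_sum]

theorem avg_cs (u : ℕ → ℂ) (N : ℕ) :
    ‖avg u N‖ ^ 2 ≤ ‖avg (fun n => u n * (starRingEnd ℂ) (u n)) N‖ := by
  have e : ∀ n, u n * (starRingEnd ℂ) (u n) = ((‖u n‖ ^ 2 : ℝ) : ℂ) := by
    intro n; rw [Complex.mul_conj, Complex.normSq_eq_norm_sq]
  unfold avg
  simp only [e]
  rw [← Complex.ofReal_sum, norm_mul, norm_mul, Complex.norm_real,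
    Real.norm_of_nonneg (Finset.sum_nonneg fun _ _ => sq_nonneg _)]
  have : ‖(1 / N : ℂ)‖ = 1 / N := by simp
  rw [this]
  have h1 : ‖∑ n ∈ Finset.range N, u n‖ ^ 2 ≤ N * ∑ n ∈ Finset.range N, ‖u n‖ ^ 2 := by
    have := sq_sum_le_card_mul_sum_sq (s := Finset.range N) (f := fun n => ‖u n‖)
    rw [Finset.card_range] at this
    refine le_trans ?_ this
    gcongr
    exact norm_sum_le _ _
  rcases Nat.eq_zero_or_pos N with rfl | hN
  · simp
  have hN' : (0 : ℝ) < N := by exact_mod_cast hN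
  calc (1 / (N : ℝ) * ‖∑ n ∈ Finset.range N, u n‖) ^ 2
      = (1 / (N : ℝ)) ^ 2 * ‖∑ n ∈ Finset.range N, u n‖ ^ 2 := by ring
    _ ≤ (1 / (N : ℝ)) ^ 2 * (N * ∑ n ∈ Finset.range N, ‖u n‖ ^ 2) := by gcongr
    _ = _ := by field_simp

theorem avg_corr (u : ℕ → ℂ) (hu : ∀ n, ‖u n‖ = 1)
    (hc : ∀ h : ℕ, 1 ≤ h → Tendsto (avg fun n => u (n + h) * (starRingEnd ℂ) (u n)) atTop (nhds 0))
    (i j : ℕ) :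
    Tendsto (avg fun n => u (n + i) * (starRingEnd ℂ) (u (n + j))) atTop
      (nhds (if i = j then 1 else 0)) := by
  have key : ∀ i j : ℕ, j < i →
      Tendsto (avg fun n => u (n + i) * (starRingEnd ℂ) (u (n + j))) atTop (nhds 0) := by
    intro i j hij
    have h1 := avg_shift (fun n => u (n + (i - j)) * (starRingEnd ℂ) (u n))
      (fun n => by simp [hu]) j
    have h2 := h1.add (hc (i - j) (by omega))
    simp only [sub_add_cancel, add_zero] at h2
    refine h2.congr fun N => ?_
    congr 1
    funext n
    rw [show n + j + (i - j) = n + i by omega]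
  rcases lt_trichotomy i j with h | h | h
  · rw [if_neg h.ne]
    have h1 := key j i h
    have h2 := (Complex.continuous_conj.tendsto 0).comp h1
    rw [map_zero] at h2
    refine h2.congr fun N => ?_
    simp only [Function.comp, avg, map_mul, map_sum, Complex.conj_conj]
    simp [mul_comm]
  · subst h
    rw [if_pos rfl]
    refine tendsto_const_nhds.congr' ?_
    filter_upwards [eventually_gt_atTop 0] with N hN
    rw [← avg_one N hN]
    congr 1
    funext n
    rw [Complex.mul_conj, Complex.normSq_eq_norm_sq, hu]; simp
  · rw [if_neg h.ne']
    exact key i j h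

theorem vdc (u : ℕ → ℂ) (hu : ∀ n, ‖u n‖ = 1)
    (hc : ∀ h : ℕ, 1 ≤ h →
      Tendsto (avg fun n => u (n + h) * (starRingEnd ℂ) (u n)) atTop (nhds 0)) :
    Tendsto (avg u) atTop (nhds 0) := by
  rw [Metric.tendsto_atTop']
  intro ε hε
  obtain ⟨H, hH⟩ := exists_nat_gt (2 / (ε / 2) ^ 2)
  have hH0 : (0 : ℝ) < H := lt_trans (by positivity) hH
  have hH1 : (H : ℂ) ≠ 0 := by exact_mod_cast hH0.ne'
  -- the windowed sum
  let w : ℕ → ℂ := fun n => ∑ h ∈ Finset.range H, u (n + h)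
  have t1 : Tendsto (fun N => avg w N - H * avg u N) atTop (nhds 0) := by
    have : Tendsto (fun N => ∑ h ∈ Finset.range H, (avg (fun n => u (n + h)) N - avg u N)) atTop
        (nhds (∑ h ∈ Finset.range H, 0)) := tendsto_finsetSum _ fun h _ => avg_shift u hu h
    rw [Finset.sum_const_zero] at this
    refine this.congr fun N => ?_
    rw [Finset.sum_sub_distrib, ← avg_sum]
    simp [w]
  have t2 : Tendsto (avg fun n => w n * (starRingEnd ℂ) (w n)) atTop (nhds (H : ℂ)) := by
    have : Tendsto (fun N => ∑ i ∈ Finset.range H, ∑ j ∈ Finset.range H,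
        avg (fun n => u (n + i) * (starRingEnd ℂ) (u (n + j))) N) atTop
        (nhds (∑ i ∈ Finset.range H, ∑ j ∈ Finset.range H, if i = j then 1 else 0)) :=
      tendsto_finsetSum _ fun i _ => tendsto_finsetSum _ fun j _ => avg_corr u hu hc i j
    have e : (∑ i ∈ Finset.range H, ∑ j ∈ Finset.range H, if i = j then (1 : ℂ) else 0) = H := by
      rw [Finset.sum_congr rfl (g := fun _ => (1 : ℂ))]
      · simp
      · intro i hi
        rw [Finset.sum_ite_eq, if_pos hi]
    rw [e] at this
    refine this.congr fun N => ?_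
    simp only [← avg_sum]
    congr 1
    funext n
    simp only [w, map_sum, Finset.sum_mul_sum]
  have e1 : ∀ᶠ N in atTop, ‖avg w N - H * avg u N‖ < H * (ε / 2) := by
    have := (tendsto_zero_iff_norm_tendsto_zero.1 t1)
    exact this.eventually_lt_const (by positivity)
  have e2 : ∀ᶠ N in atTop, ‖avg (fun n => w n * (starRingEnd ℂ) (w n)) N‖ < 2 * H := by
    have := t2.norm
    refine this.eventually_lt_const ?_
    rw [Complex.norm_natCast]; linarith
  obtain ⟨M, hM⟩ := eventually_atTop.1 (e1.and e2)
  refine ⟨M, fun N hN => ?_⟩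
  obtain ⟨h1, h2⟩ := hM N hN.le
  have h3 := (avg_cs w N).trans h2.le
  have h4 : ‖avg w N‖ < H * (ε / 2) := by
    apply lt_of_pow_lt_pow_left₀ 2 (by positivity)
    refine lt_of_le_of_lt h3 ?_
    rw [div_lt_iff₀ (by positivity)] at hH
    nlinarith
  rw [dist_zero_right]
  have h5 : ‖(H : ℂ) * avg u N‖ ≤ ‖avg w N‖ + ‖avg w N - H * avg u N‖ := by
    have := norm_sub_le (avg w N) (avg w N - H * avg u N)
    simpa using this
  rw [norm_mul, Complex.norm_natCast] at h5
  have : (H : ℝ) * ‖avg u N‖ < H * ε := by linarith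
  exact lt_of_mul_lt_mul_left this hH0.le

theorem poly_step (β : ℝ) (d : ℕ) : ∀ c : ℝ,
    (∀ l : List ℕ, (∀ h ∈ l, 1 ≤ h) →
      Tendsto (avg fun n => ee (c * β ^ n * (l.map fun h => β ^ h - 1).prod)) atTop (nhds 0)) →
    ∀ P : Polynomial ℝ, P.degree < d →
      Tendsto (avg fun n => ee (c * β ^ n + P.eval (n : ℝ))) atTop (nhds 0) := by
  induction d with
  | zero =>
    intro c hc P hP
    have : P = 0 := by
      rw [← Polynomial.degree_eq_bot]
      simpa [Nat.WithBot.lt_zero_iff] using hP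
    subst this
    simpa using hc [] (by simp)
  | succ d ih =>
    intro c hc P hP
    apply vdc _ (fun n => ee_norm _)
    intro h hh
    have hdeg : (Polynomial.taylor (h : ℝ) P - P).degree < d := by
      by_cases hP0 : P = 0
      · subst hP0; simp
      · have h1 : (Polynomial.taylor (h : ℝ) P - P).degree < P.degree := by
          rw [← Polynomial.degree_taylor P (h : ℝ)]
          apply Polynomial.degree_sub_lt_left
          · exact Polynomial.degree_taylor P _
          · simpa using hP0
          · simp
        refine lt_of_lt_of_le h1 ?_
        rw [Polynomial.degree_eq_natDegree hP0] at hP ⊢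
        have : P.natDegree < d + 1 := by exact_mod_cast hP
        exact_mod_cast Nat.lt_succ_iff.1 this
    have := ih (c * (β ^ h - 1)) (fun l hl => by
      have := hc (h :: l) (by simpa using ⟨hh, hl⟩)
      refine this.congr fun N => ?_
      congr 1
      funext n
      rw [List.map_cons, List.prod_cons]
      congr 1; ring) _ hdeg
    refine this.congr fun N => ?_
    congr 1
    funext n
    rw [ee_sub, Polynomial.eval_sub, Polynomial.taylor_eval]
    congr 1
    push_cast
    ring_nf


def Good (G G1 G2 : ℝ → ℝ) : Prop := ∀ x, 1 < x →
  0 < G x ∧ 0 ≤ G1 x ∧ 0 ≤ G2 x ∧ HasDerivAt G (G1 x) x ∧ HasDerivAt G1 (G2 x) x ∧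
    ContinuousAt G2 x

theorem Good.mul {F F1 F2 G G1 G2 : ℝ → ℝ} (hF : Good F F1 F2) (hG : Good G G1 G2) :
    Good (fun x => F x * G x) (fun x => F1 x * G x + F x * G1 x)
      (fun x => (F2 x * G x + F1 x * G1 x) + (F1 x * G1 x + F x * G2 x)) := by
  intro x hx
  obtain ⟨a1, a2, a3, a4, a5, a6⟩ := hF x hx
  obtain ⟨b1, b2, b3, b4, b5, b6⟩ := hG x hx
  refine ⟨by positivity, by positivity, by positivity, a4.mul b4,
    (a5.mul b4).add (a4.mul b5), ?_⟩
  exact ((a6.mul b4.continuousAt).add (a5.continuousAt.mul b5.continuousAt)).add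
    ((a5.continuousAt.mul b5.continuousAt).add (a4.continuousAt.mul b6))

theorem good_pow (m : ℕ) : Good (fun x => x ^ m) (fun x => m * x ^ (m - 1))
    (fun x => m * (((m - 1 : ℕ) : ℝ) * x ^ (m - 1 - 1))) := by
  intro x hx
  have : 0 < x := by linarith
  exact ⟨by positivity, by positivity, by positivity, hasDerivAt_pow m x,
    (hasDerivAt_pow (m - 1) x).const_mul _, by fun_prop⟩

theorem good_pow_sub_one (h : ℕ) (hh : 1 ≤ h) : Good (fun x => x ^ h - 1)
    (fun x => h * x ^ (h - 1)) (fun x => h * (((h - 1 : ℕ) : ℝ) * x ^ (h - 1 - 1))) := by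
  intro x hx
  have : 0 < x := by linarith
  exact ⟨by linarith [one_lt_pow₀ hx (by omega : h ≠ 0)], by positivity, by positivity,
    (hasDerivAt_pow h x).sub_const 1, (hasDerivAt_pow (h - 1) x).const_mul _, by fun_prop⟩

theorem good_list {G G1 G2 : ℝ → ℝ} (hG : Good G G1 G2) (l : List ℕ) (hl : ∀ h ∈ l, 1 ≤ h) :
    ∃ F F1 F2, Good F F1 F2 ∧ ∀ x, F x = G x * (l.map fun h => x ^ h - 1).prod := by
  induction l with
  | nil => exact ⟨G, G1, G2, hG, by simp⟩
  | cons h l ih =>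
    obtain ⟨F, F1, F2, hF, e⟩ := ih fun k hk => hl k (by simp [hk])
    refine ⟨_, _, _, (good_pow_sub_one h (hl h (by simp))).mul hF, fun x => ?_⟩
    simp only [e, List.map_cons, List.prod_cons]; ring

theorem good_of (g : ℝ → ℝ)
    (hg_pos : ∀ x ∈ Set.Ioi (1 : ℝ), 0 < g x)
    (hg_smooth : ContDiffOn ℝ 2 g (Set.Ioi 1))
    (hg_deriv1 : ∀ x ∈ Set.Ioi (1 : ℝ), 0 ≤ deriv g x)
    (hg_deriv2 : ∀ x ∈ Set.Ioi (1 : ℝ), 0 ≤ deriv (deriv g) x) :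
    Good g (deriv g) (deriv (deriv g)) := by
  intro x hx
  have ho : IsOpen (Set.Ioi (1 : ℝ)) := isOpen_Ioi
  have hn : Set.Ioi (1 : ℝ) ∈ nhds x := ho.mem_nhds hx
  have h1 : ContDiffOn ℝ (1 + 1) g (Set.Ioi 1) := by
    convert hg_smooth using 1; norm_num
  obtain ⟨d1, -, h2⟩ := (contDiffOn_succ_iff_deriv_of_isOpen ho).1 h1
  have h2' : ContDiffOn ℝ (0 + 1) (deriv g) (Set.Ioi 1) := by simpa using h2
  obtain ⟨d2, -, h3⟩ := (contDiffOn_succ_iff_deriv_of_isOpen ho).1 h2'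
  exact ⟨hg_pos x hx, hg_deriv1 x hx, hg_deriv2 x hx, (d1.differentiableAt hn).hasDerivAt,
    (d2.differentiableAt hn).hasDerivAt, h3.continuousOn.continuousAt hn⟩

theorem vdc_int {H H1 H2 : ℝ → ℝ} (hH : Good H H1 H2) (a b : ℝ) (ha : 1 < a) (hab : a ≤ b)
    (L c : ℝ) (hL : 0 < L) (hc : c ≠ 0) (hb : ∀ x ∈ Set.Icc a b, L ≤ H1 x) :
    ‖∫ x in a..b, Complex.exp (Complex.I * (c * H x : ℝ))‖ ≤ 3 / (|c| * L) := by
  have hcp : 0 < |c| := abs_pos.2 hc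
  have hx1 : ∀ x ∈ Set.Icc a b, 1 < x := fun x hx => lt_of_lt_of_le ha hx.1
  have hu : Set.uIcc a b = Set.Icc a b := Set.uIcc_of_le hab
  let E : ℝ → ℂ := fun x => Complex.exp (Complex.I * (c * H x : ℝ))
  have hE : ∀ x, ‖E x‖ = 1 := fun x => by
    simp only [E]; rw [mul_comm]; exact Complex.norm_exp_ofReal_mul_I _
  have dE : ∀ x ∈ Set.Icc a b, HasDerivAt E (E x * (Complex.I * (c * H1 x : ℝ))) x := by
    intro x hx
    obtain ⟨-, -, -, h, -, -⟩ := hH x (hx1 x hx)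
    exact (((h.const_mul c).ofReal_comp).const_mul Complex.I).cexp
  let q : ℝ → ℝ := fun x => (H1 x)⁻¹
  have dq : ∀ x ∈ Set.Icc a b, HasDerivAt q (-H2 x / H1 x ^ 2) x := by
    intro x hx
    obtain ⟨-, -, -, -, h, -⟩ := hH x (hx1 x hx)
    exact h.inv (by linarith [hb x hx])
  have cE : ContinuousOn E (Set.Icc a b) := fun x hx => (dE x hx).continuousAt.continuousWithinAt
  have cH1 : ContinuousOn H1 (Set.Icc a b) := fun x hx =>
    (hH x (hx1 x hx)).2.2.2.2.1.continuousAt.continuousWithinAt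
  have cH2 : ContinuousOn H2 (Set.Icc a b) := fun x hx =>
    (hH x (hx1 x hx)).2.2.2.2.2.continuousWithinAt
  have cq' : ContinuousOn (fun x => -H2 x / H1 x ^ 2) (Set.Icc a b) := by
    apply cH2.neg.div (cH1.pow 2)
    intro x hx
    have := hb x hx
    exact pow_ne_zero _ (by linarith)
  let K : ℂ := 1 / (Complex.I * c)
  have hcC : (c : ℂ) ≠ 0 := by exact_mod_cast hc
  have hK : ‖K‖ = 1 / |c| := by simp [K]
  have dF : ∀ x ∈ Set.uIcc a b, HasDerivAt (fun x => K * (E x * (q x : ℂ)))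
      (E x + K * (E x * ((-H2 x / H1 x ^ 2 : ℝ) : ℂ))) x := by
    intro x hx
    rw [hu] at hx
    have h1 := ((dE x hx).mul (dq x hx).ofReal_comp).const_mul K
    have h0 : (H1 x : ℂ) ≠ 0 := by
      have := hb x hx
      exact_mod_cast (by linarith : H1 x ≠ 0)
    have e : E x + K * (E x * ((-H2 x / H1 x ^ 2 : ℝ) : ℂ)) =
        K * (E x * (Complex.I * (c * H1 x : ℝ)) * (q x : ℂ) +
          E x * ((-H2 x / H1 x ^ 2 : ℝ) : ℂ)) := by
      simp only [K, q]
      push_cast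
      field_simp
    rw [e]
    exact h1
  have i1 : IntervalIntegrable E volume a b := (cE.mono hu.le).intervalIntegrable
  have c2 : ContinuousOn (fun x => K * (E x * ((-H2 x / H1 x ^ 2 : ℝ) : ℂ))) (Set.Icc a b) :=
    continuousOn_const.mul (cE.mul (Complex.continuous_ofReal.comp_continuousOn cq'))
  have i2 : IntervalIntegrable (fun x => K * (E x * ((-H2 x / H1 x ^ 2 : ℝ) : ℂ))) volume a b :=
    (c2.mono hu.le).intervalIntegrable
  have i3 : IntervalIntegrable (fun x => -H2 x / H1 x ^ 2) volume a b :=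
    (cq'.mono hu.le).intervalIntegrable
  have f1 := intervalIntegral.integral_eq_sub_of_hasDerivAt dF (i1.add i2)
  have f2 := intervalIntegral.integral_eq_sub_of_hasDerivAt (fun x hx => dq x (hu ▸ hx)) i3
  rw [intervalIntegral.integral_add i1 i2] at f1
  have n2 : ‖∫ x in a..b, K * (E x * ((-H2 x / H1 x ^ 2 : ℝ) : ℂ))‖ ≤ 1 / |c| * (q a - q b) := by
    have e : 1 / |c| * (q a - q b) = ∫ x in a..b, 1 / |c| * -(-H2 x / H1 x ^ 2) := by
      rw [intervalIntegral.integral_const_mul, intervalIntegral.integral_neg, f2]; ring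
    rw [e]
    apply intervalIntegral.norm_integral_le_of_norm_le hab
    · refine ae_of_all _ fun x hx => ?_
      have hx' : x ∈ Set.Icc a b := ⟨hx.1.le, hx.2⟩
      rw [norm_mul, norm_mul, hE, hK, one_mul, Complex.norm_real, Real.norm_eq_abs]
      gcongr
      rw [abs_of_nonpos]
      have := (hH x (hx1 x hx')).2.2.1
      apply div_nonpos_of_nonpos_of_nonneg (by linarith) (by positivity)
    · exact i3.neg.const_mul _
  have qb : ∀ x ∈ Set.Icc a b, 0 ≤ q x ∧ q x ≤ 1 / L := by
    intro x hx
    have := hb x hx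
    refine ⟨inv_nonneg.2 (by linarith), ?_⟩
    simp only [q]
    rw [← one_div]
    exact one_div_le_one_div_of_le hL this
  have qa := qb a ⟨le_rfl, hab⟩
  have qbb := qb b ⟨hab, le_rfl⟩
  have nF : ∀ x ∈ Set.Icc a b, ‖K * (E x * (q x : ℂ))‖ ≤ 1 / |c| * (1 / L) := by
    intro x hx
    rw [norm_mul, norm_mul, hE, hK, one_mul, Complex.norm_real, Real.norm_of_nonneg (qb x hx).1]
    gcongr
    exact (qb x hx).2
  have e0 : (∫ x in a..b, E x) = (K * (E b * (q b : ℂ)) - K * (E a * (q a : ℂ)))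
      - ∫ x in a..b, K * (E x * ((-H2 x / H1 x ^ 2 : ℝ) : ℂ)) := by
    rw [← f1]; ring
  change ‖∫ x in a..b, E x‖ ≤ _
  rw [e0]
  have m1 := norm_sub_le (K * (E b * (q b : ℂ)) - K * (E a * (q a : ℂ)))
    (∫ x in a..b, K * (E x * ((-H2 x / H1 x ^ 2 : ℝ) : ℂ)))
  have m2 := norm_sub_le (K * (E b * (q b : ℂ))) (K * (E a * (q a : ℂ)))
  have m3 := nF a ⟨le_rfl, hab⟩
  have m4 := nF b ⟨hab, le_rfl⟩
  have m5 : 1 / |c| * (q a - q b) ≤ 1 / |c| * (1 / L) := by gcongr; linarith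
  have e3 : 3 / (|c| * L) = 3 * (1 / |c| * (1 / L)) := by field_simp
  rw [e3]
  linarith

theorem corr_bound {G G1 G2 : ℝ → ℝ} (hG : Good G G1 G2) (a b : ℝ) (ha : 1 < a) (hab : a ≤ b)
    (c₀ : ℝ) (hc₀ : 0 < c₀) : ∃ K, 0 ≤ K ∧ ∀ m d : ℕ, 1 ≤ d → ∀ c : ℝ, |c| = c₀ →
      ‖∫ x in a..b, Complex.exp (Complex.I * (c * (x ^ m * (x ^ d - 1) * G x) : ℝ))‖ ≤
        K * ((√a)⁻¹ ^ m * (√a)⁻¹ ^ (m + d)) := by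
  have cG : ContinuousOn G (Set.Icc a b) := fun x hx =>
    (hG x (lt_of_lt_of_le ha hx.1)).2.2.2.1.continuousAt.continuousWithinAt
  obtain ⟨x0, hx0, hmin⟩ := isCompact_Icc.exists_isMinOn ⟨a, le_rfl, hab⟩ cG
  have hγ : 0 < G x0 := (hG x0 (lt_of_lt_of_le ha hx0.1)).1
  set γ := G x0 with hγd
  have ha0 : 0 < a := by linarith
  refine ⟨3 * a / (c₀ * γ), by positivity, fun m d hd c hc => ?_⟩
  have hc0 : c ≠ 0 := by
    intro h; rw [h, abs_zero] at hc; linarith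
  have hgood := ((good_pow m).mul (good_pow_sub_one d hd)).mul hG
  have h1 := vdc_int hgood a b ha hab (a ^ (m + d - 1) * γ) c (by positivity) hc0 (by
    intro x hx
    have hx1 : 1 < x := lt_of_lt_of_le ha hx.1
    have hx0 : 0 < x := by linarith
    obtain ⟨g1, g2, -⟩ := hG x hx1
    have g3 : γ ≤ G x := hmin hx
    have p1 : 1 ≤ x ^ d := one_le_pow₀ hx1.le
    have p2 : (0 : ℝ) ≤ m * x ^ (m - 1) * (x ^ d - 1) := by
      have : 0 ≤ x ^ d - 1 := by linarith
      positivity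
    have p3 : a ^ (m + d - 1) ≤ x ^ m * (d * x ^ (d - 1)) := by
      calc a ^ (m + d - 1) ≤ x ^ (m + d - 1) := by gcongr; exact hx.1
        _ = x ^ m * (1 * x ^ (d - 1)) := by
          rw [one_mul, ← pow_add]; congr 1; omega
        _ ≤ _ := by
          gcongr
          exact_mod_cast hd
    have p4 : 0 ≤ x ^ m * (x ^ d - 1) * G1 x := by
      have : 0 ≤ x ^ d - 1 := by linarith
      positivity
    calc a ^ (m + d - 1) * γ
        ≤ (m * x ^ (m - 1) * (x ^ d - 1) + x ^ m * (d * x ^ (d - 1))) * G x := by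
          apply mul_le_mul (by linarith) g3 hγ.le
          have : 0 ≤ a ^ (m + d - 1) := by positivity
          linarith
      _ ≤ _ := by linarith)
  refine h1.trans ?_
  rw [hc]
  have e1 : 3 / (c₀ * (a ^ (m + d - 1) * γ)) = 3 * a / (c₀ * γ) * (a ^ (m + d))⁻¹ := by
    have : a ^ (m + d) = a ^ (m + d - 1) * a := by rw [← pow_succ]; congr 1; omega
    rw [this]; field_simp
  rw [e1]
  gcongr
  have hs : 1 ≤ √a := by rw [Real.one_le_sqrt]; exact ha.le
  have e2 : a ^ (m + d) = √a ^ (2 * (m + d)) := by rw [pow_mul, Real.sq_sqrt ha0.le]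
  rw [← pow_add, inv_pow, e2]
  gcongr
  omega

theorem l2_bound {G G1 G2 : ℝ → ℝ} (hG : Good G G1 G2) (a b : ℝ) (ha : 1 < a) (hab : a ≤ b)
    (α : ℝ) (hα : α ≠ 0) : ∃ C, 0 ≤ C ∧ ∀ N : ℕ, 1 ≤ N →
      ∫ x in a..b, ‖∑ n ∈ Finset.range N, ee (α * x ^ n * G x)‖ ^ 2 ≤ C * N := by
  obtain ⟨K, hK, hb⟩ := corr_bound hG a b ha hab (2 * Real.pi * |α|)
    (by have := abs_pos.2 hα; positivity)
  have ha0 : 0 < a := by linarith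
  set s := (√a)⁻¹ with hs
  have hs0 : 0 ≤ s := by positivity
  have hs1 : s < 1 := by
    apply inv_lt_one_of_one_lt₀
    rw [Real.lt_sqrt zero_le_one]; simpa using ha
  have hu : Set.uIcc a b = Set.Icc a b := Set.uIcc_of_le hab
  have cG : ContinuousOn G (Set.Icc a b) := fun x hx =>
    (hG x (lt_of_lt_of_le ha hx.1)).2.2.2.1.continuousAt.continuousWithinAt
  have bnd : ∀ n m : ℕ, ‖∫ x in a..b, ee (α * x ^ n * G x - α * x ^ m * G x)‖ ≤
      (if n = m then b - a else 0) + K * (s ^ n * s ^ m) := by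
    intro n m
    have e : ∀ n m : ℕ, m < n → ∀ x, ee (α * x ^ n * G x - α * x ^ m * G x) =
        Complex.exp (Complex.I * ((2 * Real.pi * α) * (x ^ m * (x ^ (n - m) - 1) * G x) : ℝ)) := by
      intro n m h x
      unfold ee
      congr 1
      have : x ^ n = x ^ m * x ^ (n - m) := by rw [← pow_add]; congr 1; omega
      rw [this]; push_cast; ring
    have e' : ∀ n m : ℕ, n < m → ∀ x, ee (α * x ^ n * G x - α * x ^ m * G x) =
        Complex.exp (Complex.I * ((-(2 * Real.pi * α)) * (x ^ n * (x ^ (m - n) - 1) * G x) : ℝ)) := by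
      intro n m h x
      unfold ee
      congr 1
      have : x ^ m = x ^ n * x ^ (m - n) := by rw [← pow_add]; congr 1; omega
      rw [this]; push_cast; ring
    have ab : |2 * Real.pi * α| = 2 * Real.pi * |α| := by
      rw [abs_mul, abs_of_pos (by positivity)]
    rcases lt_trichotomy n m with h | h | h
    · rw [if_neg h.ne, zero_add]
      simp only [e' n m h]
      have := hb n (m - n) (by omega) (-(2 * Real.pi * α)) (by rw [abs_neg, ab])
      rwa [show n + (m - n) = m by omega] at this
    · subst h
      have h0 : ee 0 = 1 := by simp [ee]
      simp only [sub_self, h0, if_true]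
      have : 0 ≤ K * (s ^ n * s ^ n) := by positivity
      rw [intervalIntegral.integral_const, norm_smul, norm_one, mul_one, Real.norm_eq_abs,
        abs_of_nonneg (by linarith)]
      linarith
    · rw [if_neg h.ne', zero_add]
      simp only [e n m h]
      have := hb m (n - m) (by omega) (2 * Real.pi * α) ab
      rw [show m + (n - m) = n by omega] at this
      rwa [mul_comm (s ^ n)]
  have ci : ∀ n m : ℕ, IntervalIntegrable
      (fun x => ee (α * x ^ n * G x - α * x ^ m * G x)) volume a b := by
    intro n m
    apply ContinuousOn.intervalIntegrable
    rw [hu]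
    unfold ee
    fun_prop
  have key : ∀ N : ℕ, ((∫ x in a..b, ‖∑ n ∈ Finset.range N, ee (α * x ^ n * G x)‖ ^ 2 : ℝ) : ℂ) =
      ∑ n ∈ Finset.range N, ∑ m ∈ Finset.range N,
        ∫ x in a..b, ee (α * x ^ n * G x - α * x ^ m * G x) := by
    intro N
    rw [← intervalIntegral.integral_ofReal]
    simp only [← Complex.normSq_eq_norm_sq, ← Complex.mul_conj, map_sum, Finset.sum_mul_sum, ee_sub]
    rw [intervalIntegral.integral_finsetSum]
    · refine Finset.sum_congr rfl fun n _ => ?_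
      rw [intervalIntegral.integral_finsetSum]
      exact fun m _ => ci n m
    · intro n _
      have := IntervalIntegrable.sum (Finset.range N) fun m _ => ci n m
      simpa only [Finset.sum_fn] using this
  refine ⟨(b - a) + K * (1 - s)⁻¹ ^ 2, by
    have : 0 ≤ b - a := by linarith
    positivity, fun N hN => ?_⟩
  have hN' : (1 : ℝ) ≤ N := by exact_mod_cast hN
  have geo : ∑ n ∈ Finset.range N, s ^ n ≤ (1 - s)⁻¹ := by
    rw [← tsum_geometric_of_lt_one hs0 hs1]
    exact (summable_geometric_of_lt_one hs0 hs1).sum_le_tsum _ fun _ _ => by positivity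
  calc ∫ x in a..b, ‖∑ n ∈ Finset.range N, ee (α * x ^ n * G x)‖ ^ 2
      ≤ ‖((∫ x in a..b, ‖∑ n ∈ Finset.range N, ee (α * x ^ n * G x)‖ ^ 2 : ℝ) : ℂ)‖ := by
        rw [Complex.norm_real]; exact le_abs_self _
    _ ≤ ∑ n ∈ Finset.range N, ∑ m ∈ Finset.range N,
          ((if n = m then b - a else 0) + K * (s ^ n * s ^ m)) := by
        rw [key]
        refine (norm_sum_le _ _).trans (Finset.sum_le_sum fun n _ => ?_)
        exact (norm_sum_le _ _).trans (Finset.sum_le_sum fun m _ => bnd n m)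
    _ = N * (b - a) + K * (∑ n ∈ Finset.range N, s ^ n) ^ 2 := by
        simp only [Finset.sum_add_distrib, ← Finset.mul_sum, sq, Finset.sum_mul_sum]
        congr 1
        rw [Finset.sum_congr rfl (g := fun _ => b - a)]
        · rw [Finset.sum_const, Finset.card_range, nsmul_eq_mul]
        · intro i hi
          rw [Finset.sum_ite_eq, if_pos hi]
    _ ≤ N * (b - a) + K * ((1 - s)⁻¹) ^ 2 := by
        have : 0 ≤ ∑ n ∈ Finset.range N, s ^ n := Finset.sum_nonneg fun _ _ => by positivity
        gcongr
    _ ≤ _ := by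
        have : 0 ≤ K * ((1 - s)⁻¹) ^ 2 := by positivity
        nlinarith

theorem fill_gap (u : ℕ → ℂ) (hu : ∀ n, ‖u n‖ = 1)
    (h : Tendsto (fun k : ℕ => avg u ((k + 1) ^ 2)) atTop (nhds 0)) :
    Tendsto (avg u) atTop (nhds 0) := by
  have h' : Tendsto (fun k : ℕ => avg u (k ^ 2)) atTop (nhds 0) :=
    (tendsto_add_atTop_iff_nat (f := fun k : ℕ => avg u (k ^ 2)) 1).1 h
  have hsq : Tendsto Nat.sqrt atTop atTop := by
    refine tendsto_atTop_atTop.2 fun b => ⟨b * b, fun n hn => ?_⟩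
    exact Nat.le_sqrt.2 hn
  have h1 : Tendsto (fun k : ℕ => ‖avg u (k ^ 2)‖ + 2 / (k : ℝ)) atTop (nhds 0) := by
    simpa using h'.norm.add (tendsto_const_div_atTop_nhds_zero_nat (2 : ℝ))
  refine squeeze_zero_norm' ?_ (h1.comp hsq)
  filter_upwards [eventually_ge_atTop 1] with N hN
  have hk : 1 ≤ N.sqrt := Nat.le_sqrt.2 (by simpa using hN)
  set k := N.sqrt with hkd
  have hk1 : k ^ 2 ≤ N := Nat.sqrt_le' N
  have hk2 : N ≤ k ^ 2 + 2 * k := by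
    have := Nat.lt_succ_sqrt' N
    rw [← hkd, Nat.succ_eq_add_one] at this
    nlinarith
  have hk0 : (0 : ℝ) < k := by exact_mod_cast hk
  have e : ∑ n ∈ Finset.range N, u n = ∑ n ∈ Finset.range (k ^ 2), u n
      + ∑ n ∈ Finset.range (N - k ^ 2), u (k ^ 2 + n) := by
    rw [← Finset.sum_range_add]; congr 2; omega
  have b1 : ‖∑ n ∈ Finset.range N, u n‖ ≤ ‖∑ n ∈ Finset.range (k ^ 2), u n‖ + 2 * k := by
    rw [e]
    refine (norm_add_le _ _).trans ?_
    gcongr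
    refine (norm_sum_le_of_one _ (fun n => hu _) _).trans ?_
    rw [Finset.card_range]
    have : N - k ^ 2 ≤ 2 * k := by omega
    exact_mod_cast this
  have na : ∀ M : ℕ, ‖avg u M‖ = ‖∑ n ∈ Finset.range M, u n‖ / M := by
    intro M; unfold avg; rw [norm_mul]; simp; ring
  simp only [Function.comp]
  rw [na, na, ← hkd]
  have hNk : ((k : ℝ) ^ 2) ≤ N := by exact_mod_cast hk1
  calc ‖∑ n ∈ Finset.range N, u n‖ / N ≤ (‖∑ n ∈ Finset.range (k ^ 2), u n‖ + 2 * k) / (k : ℝ) ^ 2 := by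
        gcongr
    _ = _ := by push_cast; field_simp

theorem ae_interval {G G1 G2 : ℝ → ℝ} (hG : Good G G1 G2) (a b : ℝ) (ha : 1 < a) (hab : a ≤ b)
    (α : ℝ) (hα : α ≠ 0) : ∀ᵐ x ∂(volume.restrict (Set.Ioc a b)),
      Tendsto (avg fun n => ee (α * x ^ n * G x)) atTop (nhds 0) := by
  obtain ⟨C, hC, hb⟩ := l2_bound hG a b ha hab α hα
  have cG : ContinuousOn G (Set.Icc a b) := fun x hx =>
    (hG x (lt_of_lt_of_le ha hx.1)).2.2.2.1.continuousAt.continuousWithinAt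
  let f : ℕ → ℝ → ℝ := fun k x => ‖avg (fun n => ee (α * x ^ n * G x)) ((k + 1) ^ 2)‖ ^ 2
  have cf : ∀ k, ContinuousOn (f k) (Set.Icc a b) := by
    intro k
    simp only [f, avg, ee]
    fun_prop
  have inf : ∀ k, IntegrableOn (f k) (Set.Ioc a b) := fun k =>
    ((cf k).integrableOn_Icc).mono_set Set.Ioc_subset_Icc_self
  have lf : ∀ k, ∫⁻ x in Set.Ioc a b, ENNReal.ofReal (f k x) ≤
      ENNReal.ofReal (C * (1 / ((k : ℝ) + 1) ^ 2)) := by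
    intro k
    rw [← ofReal_integral_eq_lintegral_ofReal (inf k) (ae_of_all _ fun x => by
      simp only [f]; positivity)]
    apply ENNReal.ofReal_le_ofReal
    rw [← intervalIntegral.integral_of_le hab]
    have h1 := hb ((k + 1) ^ 2) (Nat.one_le_pow _ _ (by omega))
    have e : ∀ x, f k x = (1 / ((k : ℝ) + 1) ^ 2) ^ 2 *
        ‖∑ n ∈ Finset.range ((k + 1) ^ 2), ee (α * x ^ n * G x)‖ ^ 2 := by
      intro x
      simp only [f, avg]
      rw [norm_mul, mul_pow]
      congr 2
      rw [norm_div, norm_one, Complex.norm_natCast]; push_cast; rfl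
    simp only [e]
    rw [intervalIntegral.integral_const_mul]
    calc _ ≤ (1 / ((k : ℝ) + 1) ^ 2) ^ 2 * (C * (((k + 1) ^ 2 : ℕ) : ℝ)) := by gcongr
      _ = _ := by push_cast; field_simp
  have sm : Summable fun k : ℕ => C * (1 / ((k : ℝ) + 1) ^ 2) := by
    apply Summable.mul_left
    have := (summable_nat_add_iff (f := fun k : ℕ => 1 / (k : ℝ) ^ 2) 1).2
      (Real.summable_one_div_nat_pow.2 (by norm_num))
    simpa using this
  have hm : ∀ k, AEMeasurable (fun x => ENNReal.ofReal (f k x)) (volume.restrict (Set.Ioc a b)) :=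
    fun k => (inf k).aestronglyMeasurable.aemeasurable.ennreal_ofReal
  have fin : ∫⁻ x in Set.Ioc a b, ∑' k, ENNReal.ofReal (f k x) ≠ ⊤ := by
    rw [lintegral_tsum hm]
    refine ne_top_of_le_ne_top ?_ (ENNReal.tsum_le_tsum lf)
    exact sm.tsum_ofReal_ne_top
  have ae := ae_lt_top' (AEMeasurable.tsum hm) fin
  filter_upwards [ae] with x hx
  apply fill_gap _ (fun n => ee_norm _)
  have h1 := ENNReal.tendsto_atTop_zero_of_tsum_ne_top hx.ne
  have h2 := (ENNReal.tendsto_toReal ENNReal.zero_ne_top).comp h1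
  have h3 : Tendsto (fun k => f k x) atTop (nhds 0) := by
    refine h2.congr fun k => ?_
    simp only [Function.comp]
    exact ENNReal.toReal_ofReal (by simp only [f]; positivity)
  rw [tendsto_zero_iff_norm_tendsto_zero]
  have h4 := h3.sqrt
  rw [Real.sqrt_zero] at h4
  refine h4.congr fun k => ?_
  exact Real.sqrt_sq (norm_nonneg _)

theorem ae_all {G G1 G2 : ℝ → ℝ} (hG : Good G G1 G2)
    (α : ℝ) (hα : α ≠ 0) : ∀ᵐ x ∂(volume : Measure ℝ), 1 < x →
      Tendsto (avg fun n => ee (α * x ^ n * G x)) atTop (nhds 0) := by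
  have h : ∀ j : ℕ, ∀ᵐ x ∂(volume : Measure ℝ), x ∈ Set.Ioc (1 + 1 / ((j : ℝ) + 1)) (j + 3) →
      Tendsto (avg fun n => ee (α * x ^ n * G x)) atTop (nhds 0) := by
    intro j
    rw [← ae_restrict_iff' measurableSet_Ioc]
    have : 1 / ((j : ℝ) + 1) ≤ 1 := by
      rw [div_le_one (by positivity)]; linarith [(Nat.cast_nonneg j : (0 : ℝ) ≤ j)]
    have : 0 < 1 / ((j : ℝ) + 1) := by positivity
    exact ae_interval hG _ _ (by linarith) (by linarith [(Nat.cast_nonneg j : (0 : ℝ) ≤ j)]) α hα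
  filter_upwards [ae_all_iff.2 h] with x hx h1
  obtain ⟨p, hp⟩ := exists_nat_one_div_lt (sub_pos.2 h1)
  obtain ⟨q, hq⟩ := exists_nat_gt x
  apply hx (max p q)
  have hp' : (p : ℝ) ≤ (max p q : ℕ) := by exact_mod_cast le_max_left p q
  have hq' : (q : ℝ) ≤ (max p q : ℕ) := by exact_mod_cast le_max_right p q
  constructor
  · have : 1 / (((max p q : ℕ) : ℝ) + 1) ≤ 1 / ((p : ℝ) + 1) := by gcongr
    linarith
  · linarith

/-- Let `g` be a positive `C²` function on `(1,∞)` with nonnegative first and second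
derivatives there, and let `α ≠ 0` be a fixed real number. Then for Lebesgue-almost every
`β > 1`, the sequence `c_n = e^{2πi α βⁿ g(β)}` is a higher order oscillating sequence of
order `m` (stronger version) for every `m ≥ 2`; that is, for every real-coefficient
polynomial `P`, `(1/N) ∑_{n=1}^N e^{2πi (α βⁿ g(β) + P(n))} → 0`. -/
theorem ae_higherOrderOscillating_exponential
    (g : ℝ → ℝ)
    (hg_pos : ∀ x ∈ Set.Ioi (1 : ℝ), 0 < g x)
    (hg_smooth : ContDiffOn ℝ 2 g (Set.Ioi 1))
    (hg_deriv1 : ∀ x ∈ Set.Ioi (1 : ℝ), 0 ≤ deriv g x)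
    (hg_deriv2 : ∀ x ∈ Set.Ioi (1 : ℝ), 0 ≤ deriv (deriv g) x)
    (α : ℝ) (hα : α ≠ 0) :
    ∀ᵐ β ∂(volume : Measure ℝ), 1 < β →
      ∀ P : Polynomial ℝ,
        Tendsto (fun N : ℕ => (1 / N : ℂ) * ∑ n ∈ Finset.Icc 1 N,
            Complex.exp (2 * Real.pi * Complex.I * ((α * β ^ n * g β + P.eval (n : ℝ) : ℝ))))
          atTop (nhds 0) := by
  have hG := good_of g hg_pos hg_smooth hg_deriv1 hg_deriv2
  have hl : ∀ᵐ β ∂(volume : Measure ℝ), ∀ l : List ℕ, (∀ h ∈ l, 1 ≤ h) → 1 < β →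
      Tendsto (avg fun n => ee ((α * g β) * β ^ n * (l.map fun h => β ^ h - 1).prod))
        atTop (nhds 0) := by
    rw [ae_all_iff]
    intro l
    by_cases h : ∀ h ∈ l, 1 ≤ h
    · obtain ⟨F, F1, F2, hF, e⟩ := good_list hG l h
      filter_upwards [ae_all hF α hα] with β hβ _ h1
      refine (hβ h1).congr fun N => ?_
      congr 1
      funext n
      rw [e]
      congr 1; ring
    · exact ae_of_all _ fun _ h' => absurd h' h
  filter_upwards [hl] with β hβ h1 P
  have hP : P.degree < ((P.natDegree + 1 : ℕ) : WithBot ℕ) :=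
    lt_of_le_of_lt P.degree_le_natDegree (by exact_mod_cast Nat.lt_succ_self _)
  have h2 := poly_step β (P.natDegree + 1) (α * g β) (fun l h => hβ l h h1) P hP
  have h3 := (avg_shift (fun n => ee ((α * g β) * β ^ n + P.eval (n : ℝ)))
    (fun n => ee_norm _) 1).add h2
  simp only [sub_add_cancel, add_zero] at h3
  refine h3.congr fun N => ?_
  unfold avg
  congr 1
  have e : Finset.Icc 1 N = Finset.Ico (0 + 1) (N + 1) := by ext; simp
  rw [e, ← Finset.sum_Ico_add', ← Finset.range_eq_Ico]
  refine Finset.sum_congr rfl fun n _ => ?_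
  unfold ee
  congr 2
  push_cast
  ring
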